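/- arXiv:2107.04641 — 4 statements merged into one kernel-verified Lean document; each statement's English description precedes it below -/
import Mathlib

section
/- (Proposition 3, calibration of the logit-adjusted loss for a diagonal gain matrix.) Let m ≥ 1, let G ∈ ℝ^{m×m} be diagonal with G_yy > 0 for all y, and let p ∈ Δ_m with p_y > 0 for all y. Define the logit-adjusted loss ℓ^LA(y, s) = −log( exp(s_y − log G_yy) / Σ_{j=1}^m exp(s_j − log G_jj) ). Then the conditional risk R(s) = Σ_{y=1}^m p_y ℓ^LA(y, s) attains its infimum over s ∈ ℝ^m, and its set of minimizers is exactly { s ∈ ℝ^m : ∃ c ∈ ℝ, s_y = log(G_yy p_y) + c for all y }. In particular, every minimizer s* satisfies argmax_{y} s*_y = argmax_{y} G_yy p_y (as sets). -/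
/-- The argmax set of `f` over `{1,…,m}`. -/
def argmaxSet {m : ℕ} (f : Fin m → ℝ) : Set (Fin m) :=
  {y | ∀ y', f y' ≤ f y}

theorem gibbs_term {p q : ℝ} (hp : 0 < p) (hq : 0 < q) :
    p * (-Real.log p) + (p - q) ≤ p * (-Real.log q) := by
  have h := Real.log_le_sub_one_of_pos (div_pos hq hp)
  rw [Real.log_div hq.ne' hp.ne'] at h
  have h2 := mul_le_mul_of_nonneg_left h hp.le
  have h3 : p * (q / p - 1) = q - p := by field_simp
  nlinarith

theorem gibbs_term_lt {p q : ℝ} (hp : 0 < p) (hq : 0 < q) (hne : q ≠ p) :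
    p * (-Real.log p) + (p - q) < p * (-Real.log q) := by
  have h := Real.log_lt_sub_one_of_pos (div_pos hq hp)
    (fun h => hne ((div_eq_one_iff_eq hp.ne').1 h))
  rw [Real.log_div hq.ne' hp.ne'] at h
  have h2 := mul_lt_mul_of_pos_left h hp
  have h3 : p * (q / p - 1) = q - p := by field_simp
  nlinarith

/-- Proposition 3: for a diagonal gain matrix `G` with positive
diagonal and `p ∈ Δ_m` with positive entries, the conditional risk of the
logit-adjusted loss attains its infimum, its minimizer set is exactly
`{s | ∃ c, s_y = log(G_yy p_y) + c}`, and every minimizer has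
`argmax_y s_y = argmax_y G_yy p_y`. -/
theorem logit_adjusted_loss_calibrated {m : ℕ} (hm : 1 ≤ m)
    (G : Matrix (Fin m) (Fin m) ℝ)
    (hGdiag : ∀ i j, i ≠ j → G i j = 0) (hGpos : ∀ y, 0 < G y y)
    (p : Fin m → ℝ) (hp : p ∈ stdSimplex ℝ (Fin m)) (hppos : ∀ y, 0 < p y) :
    let R : (Fin m → ℝ) → ℝ := fun s =>
      ∑ y, p y * (-Real.log (Real.exp (s y - Real.log (G y y)) /
          ∑ j, Real.exp (s j - Real.log (G j j))))
    (∃ s : Fin m → ℝ, ∀ t : Fin m → ℝ, R s ≤ R t) ∧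
    ({s : Fin m → ℝ | ∀ t : Fin m → ℝ, R s ≤ R t}
      = {s : Fin m → ℝ | ∃ c : ℝ, ∀ y, s y = Real.log (G y y * p y) + c}) ∧
    (∀ s : Fin m → ℝ, (∀ t : Fin m → ℝ, R s ≤ R t) →
      argmaxSet s = argmaxSet (fun y => G y y * p y)) := by
  intro R
  have hne : (Finset.univ : Finset (Fin m)).Nonempty := ⟨⟨0, hm⟩, Finset.mem_univ _⟩
  have hsum : ∑ y, p y = 1 := hp.2
  let Z : (Fin m → ℝ) → ℝ := fun s => ∑ j, Real.exp (s j - Real.log (G j j))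
  have hZ : ∀ s, 0 < Z s := fun s => Finset.sum_pos (fun j _ => Real.exp_pos _) hne
  let q : (Fin m → ℝ) → Fin m → ℝ := fun s y => Real.exp (s y - Real.log (G y y)) / Z s
  have hq : ∀ s y, 0 < q s y := fun s y => div_pos (Real.exp_pos _) (hZ s)
  have hqs : ∀ s, ∑ y, q s y = 1 := fun s => by
    simp only [q]
    rw [← Finset.sum_div]
    exact div_self (hZ s).ne'
  have hR : ∀ s, R s = ∑ y, p y * (-Real.log (q s y)) := fun s => rfl
  let H : ℝ := ∑ y, p y * (-Real.log (p y))
  have hH : ∀ s, ∑ y, (p y * (-Real.log (p y)) + (p y - q s y)) = H := fun s => by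
    rw [Finset.sum_add_distrib, Finset.sum_sub_distrib, hsum, hqs]
    simp [H]
  have hlow : ∀ t, H ≤ R t := fun t => by
    rw [hR, ← hH t]
    exact Finset.sum_le_sum fun y _ => gibbs_term (hppos y) (hq t y)
  have heq : ∀ t, R t ≤ H → ∀ y, q t y = p y := fun t ht y => by
    by_contra hy
    have : H < R t := by
      rw [hR, ← hH t]
      exact Finset.sum_lt_sum (fun y _ => gibbs_term (hppos y) (hq t y))
        ⟨y, Finset.mem_univ _, gibbs_term_lt (hppos y) (hq t y) hy⟩
    linarith
  have hopt : ∀ s : Fin m → ℝ, (∃ c : ℝ, ∀ y, s y = Real.log (G y y * p y) + c) →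
      R s = H := by
    rintro s ⟨c, hc⟩
    have he : ∀ y, Real.exp (s y - Real.log (G y y)) = p y * Real.exp c := fun y => by
      rw [hc, Real.log_mul (hGpos y).ne' (hppos y).ne',
        show Real.log (G y y) + Real.log (p y) + c - Real.log (G y y) = Real.log (p y) + c by ring,
        Real.exp_add, Real.exp_log (hppos y)]
    have hZs : Z s = Real.exp c := by
      simp only [Z, he]
      rw [← Finset.sum_mul, hsum, one_mul]
    rw [hR]
    refine Finset.sum_congr rfl fun y _ => ?_
    have : q s y = p y := by
      simp only [q]
      rw [he, hZs, mul_div_assoc, div_self (Real.exp_pos c).ne', mul_one]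
    rw [this]
  have hs0 : R (fun y => Real.log (G y y * p y)) = H := hopt _ ⟨0, fun y => by simp⟩
  have hmin : ∀ s : Fin m → ℝ, (∀ t : Fin m → ℝ, R s ≤ R t) →
      ∃ c : ℝ, ∀ y, s y = Real.log (G y y * p y) + c := by
    intro s hs
    have h := heq s ((hs _).trans hs0.le)
    refine ⟨Real.log (Z s), fun y => ?_⟩
    have h1 : Real.log (q s y) = Real.log (p y) := by rw [h y]
    simp only [q] at h1
    rw [Real.log_div (Real.exp_pos _).ne' (hZ s).ne', Real.log_exp] at h1
    rw [Real.log_mul (hGpos y).ne' (hppos y).ne']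
    linarith
  refine ⟨⟨_, fun t => hs0.le.trans (hlow t)⟩, ?_, ?_⟩
  · ext s
    exact ⟨hmin s, fun h t => (hopt s h).le.trans (hlow t)⟩
  · intro s hs
    obtain ⟨c, hc⟩ := hmin s hs
    ext y
    simp only [argmaxSet, Set.mem_setOf_eq]
    refine forall_congr' fun y' => ?_
    rw [hc, hc, add_le_add_iff_right]
    exact Real.log_le_log_iff (mul_pos (hGpos y') (hppos y')) (mul_pos (hGpos y) (hppos y))
end

section
/- (Proposition 4, calibration of the hybrid loss for a general gain matrix.) Let m ≥ 1, let G ∈ ℝ^{m×m}, let D ∈ ℝ^{m×m} be diagonal with D_yy > 0 for all y, and set M = G D^{−1}. Let p ∈ Δ_m be such that (Mᵀ p)_i = Σ_{y=1}^m M_{y,i} p_y > 0 for every i. Define the hybrid loss ℓ^hyb(y, s) = −Σ_{i=1}^m M_{y,i} log( exp(s_i − log D_ii) / Σ_{j=1}^m exp(s_j − log D_jj) ). Then the conditional risk R(s) = Σ_{y=1}^m p_y ℓ^hyb(y, s) attains its infimum over s ∈ ℝ^m; a vector s* minimizes R if and only if exp(s*_i − log D_ii)/Σ_j exp(s*_j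 − log D_jj) = (Mᵀp)_i / Σ_j (Mᵀp)_j for all i, equivalently if and only if there exists c ∈ ℝ with s*_i = log((Gᵀ p)_i) + c for all i; and consequently every minimizer s* satisfies argmax_i s*_i = argmax_i (Gᵀ p)_i (as sets). -/
theorem gibbs_aux {m : ℕ} (w q : Fin m → ℝ) (hw : ∀ i, 0 < w i) (hq : ∀ i, 0 < q i)
    (hq1 : ∑ i, q i = 1) (hW : 0 < ∑ i, w i) :
    ∑ i, w i * Real.log (q i) ≤ ∑ i, w i * Real.log (w i / ∑ j, w j) ∧
    (∑ i, w i * Real.log (w i / ∑ j, w j) ≤ ∑ i, w i * Real.log (q i) →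
      ∀ i, q i = w i / ∑ j, w j) := by
  set W := ∑ j, w j with hWdef
  have key : ∀ i, w i * Real.log (q i) - w i * Real.log (w i / W)
      = w i * Real.log (q i * W / w i) := by
    intro i
    have h1 := (hw i).ne'
    have h2 := (hq i).ne'
    have h3 := hW.ne'
    rw [Real.log_div (mul_ne_zero h2 h3) h1, Real.log_mul h2 h3, Real.log_div h1 h3]
    ring
  have hpos : ∀ i, 0 < q i * W / w i := fun i => div_pos (mul_pos (hq i) hW) (hw i)
  have e : ∀ i, w i * (q i * W / w i - 1) = q i * W - w i := by
    intro i
    have h1 := (hw i).ne'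
    field_simp
  have hle : ∀ i, w i * Real.log (q i) - w i * Real.log (w i / W) ≤ q i * W - w i := by
    intro i
    rw [key, ← e]
    exact mul_le_mul_of_nonneg_left (Real.log_le_sub_one_of_pos (hpos i)) (hw i).le
  have hlt : ∀ i, q i ≠ w i / W →
      w i * Real.log (q i) - w i * Real.log (w i / W) < q i * W - w i := by
    intro i hi
    rw [key, ← e]
    refine mul_lt_mul_of_pos_left (Real.log_lt_sub_one_of_pos (hpos i) ?_) (hw i)
    intro h
    apply hi
    rw [div_eq_one_iff_eq (hw i).ne'] at h
    rw [eq_div_iff hW.ne', h]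
  have hz : ∑ i, (q i * W - w i) = 0 := by
    rw [Finset.sum_sub_distrib, ← Finset.sum_mul, hq1, ← hWdef]; ring
  constructor
  · have := Finset.sum_le_sum (fun i (_ : i ∈ Finset.univ) => hle i)
    rw [hz, Finset.sum_sub_distrib] at this
    linarith
  · intro h i
    by_contra hi
    have := Finset.sum_lt_sum (fun i (_ : i ∈ Finset.univ) => hle i)
      ⟨i, Finset.mem_univ i, hlt i hi⟩
    rw [hz, Finset.sum_sub_distrib] at this
    linarith

/-- Proposition 4: for a general gain matrix `G`, a positive diagonal
matrix `D`, and `M = G D⁻¹` (entrywise `M_{y,i} = G_{y,i} / D_{ii}`), if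
`(Mᵀ p)_i > 0` for all `i`, then the conditional risk of the hybrid loss attains
its infimum; `s*` is a minimizer iff the adjusted softmax matches
`(Mᵀ p)_i / ∑_j (Mᵀ p)_j`, equivalently iff `s*_i = log((Gᵀ p)_i) + c` for some
constant `c`; and every minimizer satisfies `argmax_i s*_i = argmax_i (Gᵀ p)_i`. -/
theorem hybrid_loss_calibrated {m : ℕ} (hm : 1 ≤ m)
    (G D : Matrix (Fin m) (Fin m) ℝ)
    (hDdiag : ∀ i j, i ≠ j → D i j = 0) (hDpos : ∀ y, 0 < D y y)
    (M : Matrix (Fin m) (Fin m) ℝ) (hM : ∀ y i, M y i = G y i / D i i)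
    (p : Fin m → ℝ) (hp : p ∈ stdSimplex ℝ (Fin m))
    (hMp : ∀ i, 0 < ∑ y, M y i * p y) :
    let R : (Fin m → ℝ) → ℝ := fun s =>
      ∑ y, p y * (-∑ i, M y i * Real.log (Real.exp (s i - Real.log (D i i)) /
          ∑ j, Real.exp (s j - Real.log (D j j))))
    (∃ s : Fin m → ℝ, ∀ t : Fin m → ℝ, R s ≤ R t) ∧
    (∀ s : Fin m → ℝ,
      ((∀ t : Fin m → ℝ, R s ≤ R t) ↔
        ∀ i, Real.exp (s i - Real.log (D i i)) / (∑ j, Real.exp (s j - Real.log (D j j)))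
          = (∑ y, M y i * p y) / ∑ j, ∑ y, M y j * p y) ∧
      ((∀ t : Fin m → ℝ, R s ≤ R t) ↔
        ∃ c : ℝ, ∀ i, s i = Real.log (∑ y, G y i * p y) + c)) ∧
    (∀ s : Fin m → ℝ, (∀ t : Fin m → ℝ, R s ≤ R t) →
      argmaxSet s = argmaxSet (fun i => ∑ y, G y i * p y)) := by
  intro R
  haveI : Nonempty (Fin m) := ⟨⟨0, hm⟩⟩
  obtain ⟨w, hwdef⟩ : ∃ w : Fin m → ℝ, ∀ i, w i = ∑ y, M y i * p y := ⟨_, fun _ => rfl⟩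
  have hw : ∀ i, 0 < w i := fun i => by rw [hwdef]; exact hMp i
  have hW : 0 < ∑ i, w i := Finset.sum_pos (fun i _ => hw i) Finset.univ_nonempty
  have hg : ∀ i, ∑ y, G y i * p y = D i i * w i := by
    intro i
    rw [hwdef, Finset.mul_sum]
    refine Finset.sum_congr rfl fun y _ => ?_
    have := (hDpos i).ne'
    rw [hM]; field_simp
  have hgpos : ∀ i, 0 < ∑ y, G y i * p y := fun i => by
    rw [hg]; exact mul_pos (hDpos i) (hw i)
  have hlogg : ∀ i, Real.log (∑ y, G y i * p y) = Real.log (D i i) + Real.log (w i) := fun i => by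
    rw [hg, Real.log_mul (hDpos i).ne' (hw i).ne']
  simp only [← hwdef]
  obtain ⟨q, hqdef⟩ : ∃ q : (Fin m → ℝ) → Fin m → ℝ, ∀ s i, q s i =
      Real.exp (s i - Real.log (D i i)) / ∑ j, Real.exp (s j - Real.log (D j j)) :=
    ⟨_, fun _ _ => rfl⟩
  have hZ : ∀ s : Fin m → ℝ, 0 < ∑ j, Real.exp (s j - Real.log (D j j)) := fun s =>
    Finset.sum_pos (fun i _ => Real.exp_pos _) Finset.univ_nonempty
  have hq : ∀ s i, 0 < q s i := fun s i => by
    rw [hqdef]; exact div_pos (Real.exp_pos _) (hZ s)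
  have hq1 : ∀ s, ∑ i, q s i = 1 := fun s => by
    simp only [hqdef]
    rw [← Finset.sum_div, div_self (hZ s).ne']
  have hR : ∀ s, R s = -∑ i, w i * Real.log (q s i) := by
    intro s
    simp only [R, ← hqdef, hwdef, mul_neg, Finset.sum_neg_distrib, Finset.mul_sum, Finset.sum_mul]
    rw [Finset.sum_comm]
    congr 1
    refine Finset.sum_congr rfl fun i _ => Finset.sum_congr rfl fun y _ => ?_
    ring
  have hiff2 : ∀ s : Fin m → ℝ, (∀ i, q s i = w i / ∑ j, w j) ↔
      ∃ c : ℝ, ∀ i, s i = Real.log (∑ y, G y i * p y) + c := by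
    intro s
    constructor
    · intro h
      refine ⟨Real.log ((∑ j, Real.exp (s j - Real.log (D j j))) / ∑ j, w j), fun i => ?_⟩
      have h1 := h i
      rw [hqdef, div_eq_iff (hZ s).ne'] at h1
      have h2 := congrArg Real.log h1
      rw [Real.log_exp, div_mul_eq_mul_div, mul_div_assoc,
        Real.log_mul (hw i).ne' (div_pos (hZ s) hW).ne'] at h2
      rw [hlogg]
      linarith
    · rintro ⟨c, hc⟩ i
      have h1 : ∀ i, Real.exp (s i - Real.log (D i i)) = w i * Real.exp c := by
        intro i
        rw [hc, hlogg, show Real.log (D i i) + Real.log (w i) + c - Real.log (D i i)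
          = Real.log (w i) + c by ring, Real.exp_add, Real.exp_log (hw i)]
      rw [hqdef]
      simp only [h1]
      rw [← Finset.sum_mul, mul_div_mul_right _ _ (Real.exp_pos c).ne']
  have hmin : ∀ s : Fin m → ℝ, (∀ i, q s i = w i / ∑ j, w j) → ∀ t, R s ≤ R t := by
    intro s hs t
    rw [hR, hR]
    simp only [hs]
    exact neg_le_neg (gibbs_aux w (q t) hw (hq t) (hq1 t) hW).1
  have hs0 : ∀ i, q (fun i => Real.log (∑ y, G y i * p y)) i = w i / ∑ j, w j :=
    (hiff2 _).2 ⟨0, fun i => by simp⟩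
  have hiff1 : ∀ s : Fin m → ℝ, (∀ t, R s ≤ R t) ↔ (∀ i, q s i = w i / ∑ j, w j) := by
    intro s
    refine ⟨fun h => ?_, hmin s⟩
    have h1 := h (fun i => Real.log (∑ y, G y i * p y))
    rw [hR, hR] at h1
    simp only [hs0] at h1
    exact (gibbs_aux w (q s) hw (hq s) (hq1 s) hW).2 (neg_le_neg_iff.1 h1)
  refine ⟨⟨_, hmin _ hs0⟩, fun s => ⟨?_, (hiff1 s).trans (hiff2 s)⟩, fun s hs => ?_⟩
  · simp only [← hqdef]
    exact hiff1 s
  · obtain ⟨c, hc⟩ := (hiff2 s).1 ((hiff1 s).1 hs)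
    ext i
    simp only [argmaxSet, Set.mem_setOf_eq]
    refine forall_congr' fun j => ?_
    rw [hc i, hc j, add_le_add_iff_right, Real.log_le_log_iff (hgpos j) (hgpos i)]
end

section
/- (Proposition 5, calibration of the softmax-shifted loss.) Let m ≥ 1, let p ∈ Δ_m with p_y > 0 for all y, let α, β ∈ ℝ^m with α_y > 0 and β_y > 0 for all y, and set C = 1 + Σ_{y=1}^m β_y/α_y. Define the softmax-shifted loss ℓ^SMS(y, s) = −log( C·exp(s_y − log α_y)/Σ_{j=1}^m exp(s_j − log α_j) − β_y/α_y ) on the domain Ω = { s ∈ ℝ^m : C·exp(s_y − log α_y)/Σ_j exp(s_j − log α_j) − β_y/α_y > 0 for all y }. Then the conditional risk R(s) = Σ_{y=1}^m p_y ℓ^SMS(y, s) attains its infimum over Ω; a vector s* ∈ Ω minimizes R if and only if exp(s*_y − log α_y)/Σ_j exp(s*_j − log α_j) = (p_y + β_y/α_y)/C for all y, equivalently if and only if there exists c ∈ ℝ with s*_y = log(α_y p_y + β_y) + c for all y; and consequently every minimizer s* satisfies argmax_y s*_y = argmax_y (α_y p_y + β_y) (as sets). This is the calibration statement for the gain matrix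 G = diag(α) + 1 βᵀ, whose Bayes-optimal prediction is argmax_y (α_y p_y + β_y). -/
theorem gibbs_aux_s7 {m : ℕ} (p u : Fin m → ℝ) (hp : ∀ y, 0 < p y) (hu : ∀ y, 0 < u y)
    (hs : ∑ y, u y = ∑ y, p y) :
    (∑ y, p y * (-Real.log (p y)) ≤ ∑ y, p y * (-Real.log (u y))) ∧
    (∑ y, p y * (-Real.log (u y)) ≤ ∑ y, p y * (-Real.log (p y)) → ∀ y, u y = p y) := by
  have key : ∀ y, p y * (-Real.log (p y)) + (p y - u y) ≤ p y * (-Real.log (u y)) := by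
    intro y
    have h := Real.log_le_sub_one_of_pos (div_pos (hu y) (hp y))
    rw [Real.log_div (hu y).ne' (hp y).ne'] at h
    have h2 := mul_le_mul_of_nonneg_left h (hp y).le
    have h3 : p y * (u y / p y - 1) = u y - p y := by
      have := (hp y).ne'
      field_simp
    linarith
  have keys : ∀ y, u y ≠ p y →
      p y * (-Real.log (p y)) + (p y - u y) < p y * (-Real.log (u y)) := by
    intro y hne
    have h := Real.log_lt_sub_one_of_pos (div_pos (hu y) (hp y))
      (fun h => hne ((div_eq_one_iff_eq (hp y).ne').1 h))
    rw [Real.log_div (hu y).ne' (hp y).ne'] at h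
    have h2 := mul_lt_mul_of_pos_left h (hp y)
    have h3 : p y * (u y / p y - 1) = u y - p y := by
      have := (hp y).ne'
      field_simp
    linarith
  have e : ∑ y, (p y * (-Real.log (p y)) + (p y - u y)) = ∑ y, p y * (-Real.log (p y)) := by
    rw [Finset.sum_add_distrib, Finset.sum_sub_distrib, hs]; ring
  constructor
  · rw [← e]; exact Finset.sum_le_sum fun y _ => key y
  · intro h y
    by_contra hne
    have := Finset.sum_lt_sum (s := Finset.univ) (fun y _ => key y) ⟨y, Finset.mem_univ y, keys y hne⟩
    rw [e] at this
    linarith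

/-- Proposition 5: with `C = 1 + ∑ y β_y/α_y`, the conditional risk
of the softmax-shifted loss attains its infimum over the domain `Ω`; `s* ∈ Ω`
is a minimizer iff the `α`-adjusted softmax equals `(p_y + β_y/α_y)/C` for all
`y`, equivalently iff `s*_y = log(α_y p_y + β_y) + c` for some constant `c`; and
every minimizer satisfies `argmax_y s*_y = argmax_y (α_y p_y + β_y)`, the
Bayes-optimal prediction for the gain matrix `G = diag(α) + 1βᵀ`. -/
theorem sms_loss_calibrated {m : ℕ} (hm : 1 ≤ m)
    (p α β : Fin m → ℝ) (hp : p ∈ stdSimplex ℝ (Fin m)) (hppos : ∀ y, 0 < p y)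
    (hα : ∀ y, 0 < α y) (hβ : ∀ y, 0 < β y)
    (C : ℝ) (hC : C = 1 + ∑ y, β y / α y) :
    let q : (Fin m → ℝ) → Fin m → ℝ := fun s y =>
      Real.exp (s y - Real.log (α y)) / ∑ j, Real.exp (s j - Real.log (α j))
    let Ω : Set (Fin m → ℝ) := {s | ∀ y, 0 < C * q s y - β y / α y}
    let R : (Fin m → ℝ) → ℝ := fun s => ∑ y, p y * (-Real.log (C * q s y - β y / α y))
    (∃ s ∈ Ω, ∀ t ∈ Ω, R s ≤ R t) ∧
    (∀ s ∈ Ω,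
      ((∀ t ∈ Ω, R s ≤ R t) ↔ ∀ y, q s y = (p y + β y / α y) / C) ∧
      ((∀ t ∈ Ω, R s ≤ R t) ↔ ∃ c : ℝ, ∀ y, s y = Real.log (α y * p y + β y) + c)) ∧
    (∀ s ∈ Ω, (∀ t ∈ Ω, R s ≤ R t) →
      argmaxSet s = argmaxSet (fun y => α y * p y + β y)) := by
  intro q Ω R
  have hsum : ∑ y, p y = 1 := hp.2
  have hb : ∀ y, 0 < β y / α y := fun y => div_pos (hβ y) (hα y)
  have hCpos : 0 < C := by
    rw [hC]
    have := Finset.sum_nonneg (s := Finset.univ) (fun y _ => (hb y).le)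
    linarith
  haveI : Nonempty (Fin m) := ⟨⟨0, hm⟩⟩
  have hSpos : ∀ s : Fin m → ℝ, 0 < ∑ j, Real.exp (s j - Real.log (α j)) := fun s =>
    Finset.sum_pos (fun y _ => Real.exp_pos _) Finset.univ_nonempty
  have hq1 : ∀ s, ∑ y, q s y = 1 := by
    intro s
    simp only [q]
    rw [← Finset.sum_div]
    exact div_self (hSpos s).ne'
  have hu1 : ∀ s, ∑ y, (C * q s y - β y / α y) = ∑ y, p y := by
    intro s
    rw [Finset.sum_sub_distrib, ← Finset.mul_sum, hq1, hsum, hC]; ring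
  have hg : ∀ y, 0 < α y * p y + β y := fun y =>
    add_pos (mul_pos (hα y) (hppos y)) (hβ y)
  have hpb : ∀ y, 0 < p y + β y / α y := fun y => add_pos (hppos y) (hb y)
  have hgl : ∀ y, Real.log (α y * p y + β y) = Real.log (α y) + Real.log (p y + β y / α y) := by
    intro y
    rw [← Real.log_mul (hα y).ne' (hpb y).ne']
    congr 1
    have := (hα y).ne'
    field_simp
  have hc2q : ∀ s, (∃ c : ℝ, ∀ y, s y = Real.log (α y * p y + β y) + c) →
      ∀ y, q s y = (p y + β y / α y) / C := by
    rintro s ⟨c, hc⟩ y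
    have h1 : ∀ y, Real.exp (s y - Real.log (α y)) = (p y + β y / α y) * Real.exp c := by
      intro y
      rw [hc, hgl, show Real.log (α y) + Real.log (p y + β y / α y) + c - Real.log (α y)
        = Real.log (p y + β y / α y) + c by ring, Real.exp_add, Real.exp_log (hpb y)]
    simp only [q, h1]
    rw [← Finset.sum_mul, Finset.sum_add_distrib, hsum, ← hC]
    exact mul_div_mul_right _ _ (Real.exp_pos c).ne'
  have hq2c : ∀ s, (∀ y, q s y = (p y + β y / α y) / C) →
      (∃ c : ℝ, ∀ y, s y = Real.log (α y * p y + β y) + c) := by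
    intro s h
    refine ⟨Real.log (∑ j, Real.exp (s j - Real.log (α j))) - Real.log C, fun y => ?_⟩
    have h1 := congrArg Real.log (h y)
    simp only [q] at h1
    rw [Real.log_div (Real.exp_pos _).ne' (hSpos s).ne', Real.log_exp,
      Real.log_div (hpb y).ne' hCpos.ne'] at h1
    rw [hgl]
    linarith
  have hqu : ∀ s, (∀ y, q s y = (p y + β y / α y) / C) →
      ∀ y, C * q s y - β y / α y = p y := by
    intro s h y
    rw [h y, mul_div_cancel₀ _ hCpos.ne']; ring
  have hR : ∀ s, (∀ y, q s y = (p y + β y / α y) / C) →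
      R s = ∑ y, p y * (-Real.log (p y)) := by
    intro s h
    simp only [R, hqu s h]
  have hmin : ∀ s, (∀ y, q s y = (p y + β y / α y) / C) → ∀ t ∈ Ω, R s ≤ R t := by
    intro s h t ht
    rw [hR s h]
    exact (gibbs_aux_s7 p (fun y => C * q t y - β y / α y) hppos ht (hu1 t)).1
  let s0 : Fin m → ℝ := fun y => Real.log (α y * p y + β y)
  have hs0 : ∀ y, q s0 y = (p y + β y / α y) / C := hc2q s0 ⟨0, fun y => by simp [s0]⟩
  have hs0m : s0 ∈ Ω := fun y => by rw [hqu s0 hs0 y]; exact hppos y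
  have hmin' : ∀ s ∈ Ω, (∀ t ∈ Ω, R s ≤ R t) → ∀ y, q s y = (p y + β y / α y) / C := by
    intro s hs h y
    have h1 := h s0 hs0m
    rw [hR s0 hs0] at h1
    have h2 := (gibbs_aux_s7 p (fun y => C * q s y - β y / α y) hppos hs (hu1 s)).2 h1 y
    rw [eq_div_iff hCpos.ne']
    linarith
  refine ⟨⟨s0, hs0m, hmin s0 hs0⟩, fun s hs => ⟨⟨hmin' s hs, hmin s⟩,
    ⟨fun h => hq2c s (hmin' s hs h), fun h => hmin s (hc2q s h)⟩⟩, fun s hs h => ?_⟩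
  obtain ⟨c, hc⟩ := hq2c s (hmin' s hs h)
  ext y
  simp only [argmaxSet, Set.mem_setOf_eq]
  refine forall_congr' fun y' => ?_
  rw [hc y, hc y', add_le_add_iff_right, Real.log_le_log_iff (hg y') (hg y)]
end

section
/- (Measure-level calibration of the logit-adjusted loss, full version of Proposition 3.) Let m ≥ 1, let μ be a probability measure on a measurable space X, let p : X → Δ_m be measurable with p_y(x) > 0 for all y and x, and let G ∈ ℝ^{m×m} be diagonal with G_yy > 0 for all y. Define ℓ^LA(y, u) = −log( exp(u_y − log G_yy)/Σ_{j=1}^m exp(u_j − log G_jj) ) and the population risk L(s) = ∫_X Σ_{y=1}^m p_y(x) ℓ^LA(y, s(x)) dμ(x) for measurable s : X → ℝ^m. Then the function s* defined by s*_y(x) = log(G_yy p_y(x)) is measurable, satisfies L(s*) ≤ L(s) for every measurable s : X → ℝ^m with L(s) well-defined, and satisfies argmax_y s*_y(x) = argmax_y G_yy p_y(x) for every x ∈ X. -/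
open MeasureTheory

/-- measure-level Proposition 3: with `p : X → Δ_m` measurable and
strictly positive and `G` diagonal with positive diagonal, the scorer
`s*_y(x) = log(G_yy p_y(x))` is measurable, minimizes the population
logit-adjusted risk over all measurable scorers with well-defined risk, and its
argmax recovers the Bayes-optimal prediction `argmax_y G_yy p_y(x)` at every `x`. -/
theorem logit_adjusted_population_calibrated
    {X : Type*} [MeasurableSpace X] {m : ℕ} (hm : 1 ≤ m)
    (μ : Measure X) [IsProbabilityMeasure μ]
    (p : X → Fin m → ℝ) (hp : Measurable p)
    (hps : ∀ x, p x ∈ stdSimplex ℝ (Fin m)) (hppos : ∀ x y, 0 < p x y)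
    (G : Matrix (Fin m) (Fin m) ℝ)
    (hGdiag : ∀ i j, i ≠ j → G i j = 0) (hGpos : ∀ y, 0 < G y y) :
    let ℓLA : Fin m → (Fin m → ℝ) → ℝ := fun y u =>
      -Real.log (Real.exp (u y - Real.log (G y y)) /
        ∑ j, Real.exp (u j - Real.log (G j j)))
    let sstar : X → Fin m → ℝ := fun x y => Real.log (G y y * p x y)
    Measurable sstar ∧
    (∀ s : X → Fin m → ℝ, Measurable s →
      Integrable (fun x => ∑ y, p x y * ℓLA y (s x)) μ →
      ∫ x, ∑ y, p x y * ℓLA y (sstar x) ∂μ ≤ ∫ x, ∑ y, p x y * ℓLA y (s x) ∂μ) ∧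
    (∀ x, argmaxSet (sstar x) = argmaxSet (fun y => G y y * p x y)) := by
  intro ℓLA sstar
  have hsum : ∀ x, ∑ y, p x y = 1 := fun x => (hps x).2
  have hstar : ∀ x y, ℓLA y (sstar x) = -Real.log (p x y) := by
    intro x y
    have he : ∀ j, Real.exp (Real.log (G j j * p x j) - Real.log (G j j)) = p x j := by
      intro j
      rw [Real.log_mul (hGpos j).ne' (hppos x j).ne', add_sub_cancel_left,
        Real.exp_log (hppos x j)]
    simp only [ℓLA, sstar, he, hsum, div_one]
  refine ⟨?_, ?_, ?_⟩
  · refine measurable_pi_lambda _ fun y => ?_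
    exact Real.measurable_log.comp (measurable_const.mul ((measurable_pi_apply y).comp hp))
  · intro s _ hint
    refine integral_mono_of_nonneg (Filter.Eventually.of_forall fun x => ?_) hint
      (Filter.Eventually.of_forall fun x => ?_)
    · refine Finset.sum_nonneg fun y _ => mul_nonneg (hppos x y).le ?_
      rw [hstar]
      have h1 : p x y ≤ 1 := by
        rw [← hsum x]
        exact Finset.single_le_sum (f := p x) (fun i _ => (hppos x i).le) (Finset.mem_univ y)
      have := Real.log_nonpos (hppos x y).le h1
      linarith
    · simp only [hstar]
      set S : ℝ := ∑ j, Real.exp (s x j - Real.log (G j j)) with hS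
      have hSpos : 0 < S :=
        Finset.sum_pos (fun j _ => Real.exp_pos _) ⟨⟨0, hm⟩, Finset.mem_univ _⟩
      have key : ∀ y, p x y * -Real.log (p x y) ≤ p x y * ℓLA y (s x)
          + (Real.exp (s x y - Real.log (G y y)) / S - p x y) := by
        intro y
        have hq : 0 < Real.exp (s x y - Real.log (G y y)) / S := div_pos (Real.exp_pos _) hSpos
        change _ ≤ p x y * -Real.log (Real.exp (s x y - Real.log (G y y)) / S) + _
        generalize Real.exp (s x y - Real.log (G y y)) / S = q at hq ⊢
        have hpp := hppos x y
        have h := Real.log_le_sub_one_of_pos (div_pos hq hpp)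
        rw [Real.log_div hq.ne' hpp.ne'] at h
        have h2 := mul_le_mul_of_nonneg_left h hpp.le
        have h3 : p x y * (q / p x y - 1) = q - p x y := by field_simp
        linarith
      have h := Finset.sum_le_sum fun y (_ : y ∈ Finset.univ) => key y
      rw [Finset.sum_add_distrib, Finset.sum_sub_distrib, hsum, ← Finset.sum_div, ← hS,
        div_self hSpos.ne', sub_self, add_zero] at h
      exact h
  · intro x
    ext y
    refine forall_congr' fun y' => ?_
    exact Real.log_le_log_iff (mul_pos (hGpos y') (hppos x y')) (mul_pos (hGpos y) (hppos x y))
end
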